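/- Let n be a positive integer with n ≡ 2 (mod 4) and 3 ∤ n. Then there does not exist a connected edge-transitive (n/2, 2) biregular subgraph of K_{4,n}. -/

import Mathlib

/-- A graph is edge-transitive if its automorphism group acts transitively on its edge set. -/
def EdgeTransitive {V : Type*} (G : SimpleGraph V) : Prop :=
  ∀ e₁ ∈ G.edgeSet, ∀ e₂ ∈ G.edgeSet, ∃ φ : G ≃g G, Sym2.map φ e₁ = e₂

/-- `G` is an `(r,s)` biregular subgraph of the complete bipartite graph `K_{m,n}`:
a bipartite graph on parts `Fin m` and `Fin n` in which every edge joins the two parts,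
every vertex of the left part has degree `r`, and every vertex of the right part has
degree `s`. -/
def IsBiregularSubgraph (m n r s : ℕ) (G : SimpleGraph (Fin m ⊕ Fin n)) : Prop :=
  (∀ a b : Fin m, ¬ G.Adj (Sum.inl a) (Sum.inl b)) ∧
  (∀ a b : Fin n, ¬ G.Adj (Sum.inr a) (Sum.inr b)) ∧
  (∀ a : Fin m, (G.neighborSet (Sum.inl a)).ncard = r) ∧
  (∀ b : Fin n, (G.neighborSet (Sum.inr b)).ncard = s)

open Classical in
/-- The set of left neighbours of a right vertex. -/
noncomputable def leftNbrs {m n : ℕ} (G : SimpleGraph (Fin m ⊕ Fin n)) (b : Fin n) :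
    Finset (Fin m) :=
  Finset.univ.filter fun a => G.Adj (Sum.inl a) (Sum.inr b)

/-- The number of right vertices whose set of left neighbours is `s`. -/
noncomputable def pairMult {m n : ℕ} (G : SimpleGraph (Fin m ⊕ Fin n)) (s : Finset (Fin m)) : ℕ :=
  (Finset.univ.filter fun b => leftNbrs G b = s).card

section Bipartite

variable {m n r s : ℕ} {G : SimpleGraph (Fin m ⊕ Fin n)}

lemma mem_leftNbrs {a : Fin m} {b : Fin n} :
    a ∈ leftNbrs G b ↔ G.Adj (Sum.inl a) (Sum.inr b) := by
  simp [leftNbrs]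

lemma IsBiregularSubgraph.neighborSet_inr (h : IsBiregularSubgraph m n r s G) (b : Fin n) :
    G.neighborSet (Sum.inr b) = Sum.inl '' (leftNbrs G b : Set (Fin m)) := by
  ext (a | c)
  · simp [mem_leftNbrs, G.adj_comm]
  · simp [h.2.1 b c]

lemma IsBiregularSubgraph.card_leftNbrs (h : IsBiregularSubgraph m n r s G) (b : Fin n) :
    (leftNbrs G b).card = s := by
  have := h.2.2.2 b
  rwa [h.neighborSet_inr, Set.ncard_image_of_injective _ Sum.inl_injective,
    Set.ncard_coe_finset] at this

lemma IsBiregularSubgraph.card_filter_mem_leftNbrs (h : IsBiregularSubgraph m n r s G)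
    (a : Fin m) : (Finset.univ.filter fun b => a ∈ leftNbrs G b).card = r := by
  have : G.neighborSet (Sum.inl a)
      = Sum.inr '' ((Finset.univ.filter fun b => a ∈ leftNbrs G b : Finset (Fin n)) :
          Set (Fin n)) := by
    ext (c | b)
    · simp [h.1 a c]
    · simp [mem_leftNbrs]
  rw [← h.2.2.1 a, this, Set.ncard_image_of_injective _ Sum.inr_injective, Set.ncard_coe_finset]

lemma IsBiregularSubgraph.sum_pairMult (h : IsBiregularSubgraph m n r s G) (a : Fin m) :
    ∑ t ∈ (Finset.powersetCard s Finset.univ).filter (a ∈ ·), pairMult G t = r := by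
  rw [← h.card_filter_mem_leftNbrs a, Finset.card_eq_sum_card_fiberwise (f := leftNbrs G)
    (t := (Finset.powersetCard s Finset.univ).filter (a ∈ ·))]
  · refine Finset.sum_congr rfl fun t ht => ?_
    rw [pairMult, Finset.filter_filter]
    congr 1
    ext b
    simp only [Finset.mem_filter, Finset.mem_univ, true_and] at ht ⊢
    exact ⟨fun hb => ⟨hb ▸ ht.2, hb⟩, And.right⟩
  · intro b hb
    simpa [h.card_leftNbrs] using hb

/-- The multiplicity of the neighbourhood of a right vertex, in terms of the graph alone. -/
lemma IsBiregularSubgraph.pairMult_leftNbrs (h : IsBiregularSubgraph m n r s G) (hs : 0 < s)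
    (b : Fin n) : pairMult G (leftNbrs G b)
      = {v | G.neighborSet v = G.neighborSet (Sum.inr b)}.ncard := by
  rw [pairMult, ← Set.ncard_coe_finset, ← Set.ncard_image_of_injective _ Sum.inr_injective]
  congr 1
  ext (a | c)
  · obtain ⟨d, hd⟩ : (leftNbrs G b).Nonempty := by
      rw [← Finset.card_pos, h.card_leftNbrs]
      exact hs
    have hd' : Sum.inl d ∈ G.neighborSet (Sum.inr b) := (mem_leftNbrs.1 hd).symm
    simp only [Finset.coe_filter, Set.mem_image, reduceCtorEq, and_false, exists_false,
      Set.mem_ofPred_eq, false_iff]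
    intro he
    rw [← he] at hd'
    exact h.1 _ _ hd'
  · simp [h.neighborSet_inr, Sum.inl_injective.image_injective.eq_iff]

lemma ncard_twins_map {V : Type*} {G : SimpleGraph V} (φ : G ≃g G) (v : V) :
    {w | G.neighborSet w = G.neighborSet (φ v)}.ncard
      = {w | G.neighborSet w = G.neighborSet v}.ncard := by
  rw [← Set.ncard_image_of_injective {w | G.neighborSet w = G.neighborSet v} φ.injective]
  congr 1
  ext w
  obtain ⟨w, rfl⟩ := φ.surjective w
  simp only [Set.mem_ofPred_eq, Set.mem_image, EmbeddingLike.apply_eq_iff_eq, exists_eq_right]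
  rw [Set.ext_iff, Set.ext_iff, φ.surjective.forall]
  simp only [SimpleGraph.mem_neighborSet, φ.map_adj_iff]

lemma ncard_neighborSet_map {V : Type*} {G : SimpleGraph V} (φ : G ≃g G) (v : V) :
    (G.neighborSet (φ v)).ncard = (G.neighborSet v).ncard := by
  rw [← Set.ncard_image_of_injective (G.neighborSet v) φ.injective]
  congr 1
  ext w
  obtain ⟨w, rfl⟩ := φ.surjective w
  simp [φ.map_adj_iff]

/-- In an edge-transitive biregular graph with distinct degrees, all occurring neighbourhoods of
right vertices have the same multiplicity. -/
lemma IsBiregularSubgraph.pairMult_eq_of_edgeTransitive (h : IsBiregularSubgraph m n r s G)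
    (hs : 0 < s) (hrs : r ≠ s) (ht : EdgeTransitive G) (b c : Fin n) :
    pairMult G (leftNbrs G b) = pairMult G (leftNbrs G c) := by
  have hne : ∀ b, ∃ a, G.Adj (Sum.inl a) (Sum.inr b) := fun b => by
    obtain ⟨d, hd⟩ : (leftNbrs G b).Nonempty := by
      rw [← Finset.card_pos, h.card_leftNbrs]
      exact hs
    exact ⟨d, mem_leftNbrs.1 hd⟩
  obtain ⟨a, ha⟩ := hne b
  obtain ⟨d, hd⟩ := hne c
  obtain ⟨φ, hφ⟩ := ht s(Sum.inl a, Sum.inr b) ha s(Sum.inl d, Sum.inr c) hd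
  rw [Sym2.map_mk, Sym2.eq_iff] at hφ
  rcases hφ with ⟨-, hφ⟩ | ⟨-, hφ⟩
  · rw [h.pairMult_leftNbrs hs, h.pairMult_leftNbrs hs, ← hφ, ncard_twins_map]
  · have := ncard_neighborSet_map φ (Sum.inr b)
    rw [hφ, h.2.2.1, h.2.2.2] at this
    exact absurd this hrs

/-- If every right vertex has neighbourhood `t` or `tᶜ`, with `t` a nontrivial set of left
vertices, then the graph is disconnected. -/
lemma not_connected_of_leftNbrs (h : IsBiregularSubgraph m n r s G) {t : Finset (Fin m)}
    {x y : Fin m} (hx : x ∈ t) (hy : y ∉ t)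
    (hN : ∀ b, leftNbrs G b = t ∨ leftNbrs G b = tᶜ) : ¬ G.Connected := by
  intro hc
  let P : Fin m ⊕ Fin n → Prop := Sum.elim (· ∈ t) (fun b => leftNbrs G b = t)
  have key : ∀ a b, G.Adj (Sum.inl a) (Sum.inr b) → (a ∈ t ↔ leftNbrs G b = t) := by
    intro a b hab
    rw [← mem_leftNbrs] at hab
    rcases hN b with hb | hb
    · simpa [hb] using hab
    · rw [hb, Finset.mem_compl] at hab
      simp only [hab, false_iff]
      intro he
      rw [← he, hb] at hx
      exact Finset.mem_compl.1 hx (he ▸ hb ▸ hx)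
  have hP : ∀ u v, G.Adj u v → P u → P v := by
    rintro (a | b) (a' | b') huv hu
    · exact absurd huv (h.1 _ _)
    · exact (key a b' huv).1 hu
    · exact (key a' b huv.symm).2 hu
    · exact absurd huv (h.2.1 _ _)
  obtain ⟨w⟩ := hc.preconnected (Sum.inl x) (Sum.inl y)
  have hW : ∀ u v, G.Walk u v → P u → P v := by
    intro u v w
    induction w with
    | nil => exact id
    | cons huv _ ih => exact fun hu => ih (hP _ _ huv hu)
  exact hy (hW _ _ w hx)

end Bipartite

lemma leftNbrs_ne_of_pairMult_eq_zero {m n : ℕ} {G : SimpleGraph (Fin m ⊕ Fin n)}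
    {t : Finset (Fin m)} (ht : pairMult G t = 0) (b : Fin n) : leftNbrs G b ≠ t := by
  rw [pairMult, Finset.card_eq_zero, Finset.filter_eq_empty_iff] at ht
  exact ht (Finset.mem_univ b)

/-- If `n ≡ 2 (mod 4)` and `3 ∤ n`, then there is no connected edge-transitive
`(n/2, 2)` biregular subgraph of `K_{4,n}`. -/
theorem no_edgeTransitive_biregular_K4n (n : ℕ) (hn : 0 < n) (h4 : n % 4 = 2)
    (h3 : ¬ (3 ∣ n)) :
    ¬ ∃ G : SimpleGraph (Fin 4 ⊕ Fin n),
        IsBiregularSubgraph 4 n (n / 2) 2 G ∧ G.Connected ∧ EdgeTransitive G := by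
  rintro ⟨G, h, hc, ht⟩
  have hk : ∀ t, pairMult G t = 0 ∨ pairMult G t = pairMult G (leftNbrs G ⟨0, hn⟩) := by
    intro t
    refine or_iff_not_imp_left.2 fun h0 => ?_
    obtain ⟨b, hb⟩ := Finset.card_pos.1 (Nat.pos_of_ne_zero h0)
    rw [← (Finset.mem_filter.1 hb).2]
    exact h.pairMult_eq_of_edgeTransitive two_pos (by omega) ht _ _
  generalize pairMult G (leftNbrs G ⟨0, hn⟩) = k at hk
  have s0 := h.sum_pairMult 0
  have s1 := h.sum_pairMult 1
  have s2 := h.sum_pairMult 2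
  have s3 := h.sum_pairMult 3
  rw [show (Finset.powersetCard 2 (Finset.univ : Finset (Fin 4))).filter (0 ∈ ·)
    = {{0, 1}, {0, 2}, {0, 3}} by decide, Finset.sum_insert (by decide),
    Finset.sum_pair (by decide)] at s0
  rw [show (Finset.powersetCard 2 (Finset.univ : Finset (Fin 4))).filter (1 ∈ ·)
    = {{0, 1}, {1, 2}, {1, 3}} by decide, Finset.sum_insert (by decide),
    Finset.sum_pair (by decide)] at s1
  rw [show (Finset.powersetCard 2 (Finset.univ : Finset (Fin 4))).filter (2 ∈ ·)
    = {{0, 2}, {1, 2}, {2, 3}} by decide, Finset.sum_insert (by decide),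
    Finset.sum_pair (by decide)] at s2
  rw [show (Finset.powersetCard 2 (Finset.univ : Finset (Fin 4))).filter (3 ∈ ·)
    = {{0, 3}, {1, 3}, {2, 3}} by decide, Finset.sum_insert (by decide),
    Finset.sum_pair (by decide)] at s3
  have hf : ∀ b, leftNbrs G b = {0, 1} ∨ leftNbrs G b = {0, 2} ∨ leftNbrs G b = {0, 3} ∨
      leftNbrs G b = {1, 2} ∨ leftNbrs G b = {1, 3} ∨ leftNbrs G b = {2, 3} := fun b =>
    (by decide : ∀ t : Finset (Fin 4), t.card = 2 → t = {0, 1} ∨ t = {0, 2} ∨ t = {0, 3} ∨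
      t = {1, 2} ∨ t = {1, 3} ∨ t = {2, 3}) _ (h.card_leftNbrs b)
  have h01 := hk {0, 1}
  have h02 := hk {0, 2}
  have h03 := hk {0, 3}
  have hcases : (pairMult G {0, 2} = 0 ∧ pairMult G {0, 3} = 0 ∧ pairMult G {1, 2} = 0 ∧
        pairMult G {1, 3} = 0) ∨
      (pairMult G {0, 1} = 0 ∧ pairMult G {0, 3} = 0 ∧ pairMult G {1, 2} = 0 ∧
        pairMult G {2, 3} = 0) ∨
      (pairMult G {0, 1} = 0 ∧ pairMult G {0, 2} = 0 ∧ pairMult G {1, 3} = 0 ∧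
        pairMult G {2, 3} = 0) := by
    omega
  rcases hcases with ⟨z1, z2, z3, z4⟩ | ⟨z1, z2, z3, z4⟩ | ⟨z1, z2, z3, z4⟩
  · refine not_connected_of_leftNbrs h (t := {0, 1}) (x := 0) (y := 2) (by decide) (by decide)
      (fun b => ?_) hc
    rw [show ({0, 1} : Finset (Fin 4))ᶜ = {2, 3} by decide]
    have := hf b
    simpa [leftNbrs_ne_of_pairMult_eq_zero, z1, z2, z3, z4] using this
  · refine not_connected_of_leftNbrs h (t := {0, 2}) (x := 0) (y := 1) (by decide) (by decide)
      (fun b => ?_) hc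
    rw [show ({0, 2} : Finset (Fin 4))ᶜ = {1, 3} by decide]
    have := hf b
    simpa [leftNbrs_ne_of_pairMult_eq_zero, z1, z2, z3, z4] using this
  · refine not_connected_of_leftNbrs h (t := {0, 3}) (x := 0) (y := 1) (by decide) (by decide)
      (fun b => ?_) hc
    rw [show ({0, 3} : Finset (Fin 4))ᶜ = {1, 2} by decide]
    have := hf b
    simpa [leftNbrs_ne_of_pairMult_eq_zero, z1, z2, z3, z4] using this
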